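/- arXiv:1007.4041 — 2 statements merged into one kernel-verified Lean document; each statement's English description precedes it below -/
import Mathlib

section
/- Let n, N, k be natural numbers with k ≥ 1 and let 1 ≤ p ≤ ∞ satisfy N·p > n. (i) If f : ℝⁿ → ℂ is of class C^k with every partial derivative ∂^α f (|α| ≤ k) of polynomial decay order N, and g has vanishing moments of order k and polynomial decay order N + k + n + 1, then there is a constant C′ with ‖g * D_t f‖_{L^p} ≤ C′ t^{k + n(1 − 1/p)} for all 0 < t < 1. (ii) If instead g is of class C^k with every ∂^α g (|α| ≤ k) of polynomial decay order N, and f has vanishing moments of order k and polynomial decay order N + k + n + 1, then there is a constant C′ with ‖g * D_t f‖_{L^p} ≤ C′ t^{−k} for all t > 1. -/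
open MeasureTheory
open scoped ENNReal

/-- The `L¹`-normalized dilation `D_t f (x) = tⁿ f(t • x)` on `ℝⁿ`. -/
noncomputable def dil (n : ℕ) (t : ℝ) (f : EuclideanSpace ℝ (Fin n) → ℂ) :
    EuclideanSpace ℝ (Fin n) → ℂ :=
  fun x => (t : ℂ) ^ n * f (t • x)

/-- Convolution `(f * g)(x) = ∫ f(y) g(x − y) dy` on `ℝⁿ`. -/
noncomputable def conv (n : ℕ) (f g : EuclideanSpace ℝ (Fin n) → ℂ) :
    EuclideanSpace ℝ (Fin n) → ℂ :=
  fun x => ∫ y, f y * g (x - y)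

/-- The monomial `x^α` associated to a multi-index `α`. -/
def mono (n : ℕ) (α : Fin n → ℕ) (x : EuclideanSpace ℝ (Fin n)) : ℂ :=
  ∏ i, (x i : ℂ) ^ (α i)

/-- `f` has vanishing moments of order `k`: `∫ f(x) x^α dx = 0`, with absolute
convergence, for every multi-index `α` with `|α| ≤ k − 1`. -/
def VanishingMoments (n k : ℕ) (f : EuclideanSpace ℝ (Fin n) → ℂ) : Prop :=
  ∀ α : Fin n → ℕ, (∑ i, α i) + 1 ≤ k →
    Integrable (fun x => f x * mono n α x) ∧ (∫ x, f x * mono n α x) = 0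

lemma mono_fiber (n j : ℕ) (r : Fin j → Fin n) (x : EuclideanSpace ℝ (Fin n)) :
    mono n (fun i => (Finset.univ.filter (fun m => r m = i)).card) x
      = ∏ m, ((x (r m) : ℝ) : ℂ) := by
  unfold mono
  rw [← Finset.prod_fiberwise' Finset.univ r (fun i => ((x i : ℝ) : ℂ))]
  refine Finset.prod_congr rfl fun i _ => ?_
  rw [Finset.prod_const]

lemma multilinear_expand (n j : ℕ) (L : (EuclideanSpace ℝ (Fin n)) [×j]→L[ℝ] ℂ)
    (y : EuclideanSpace ℝ (Fin n)) :
    L (fun _ => y) = ∑ r : Fin j → Fin n,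
      mono n (fun i => (Finset.univ.filter (fun m => r m = i)).card) y *
        L (fun m => EuclideanSpace.single (r m) (1 : ℝ)) := by
  have hy : y = ∑ i, y i • EuclideanSpace.single i (1 : ℝ) := by
    ext l
    simp [Finset.sum_apply, Pi.single_apply]
  have h1 : L (fun _ => y) = L (fun _ : Fin j => ∑ i, y i • EuclideanSpace.single i (1 : ℝ)) := by
    rw [← hy]
  rw [h1, L.map_sum]
  refine Finset.sum_congr rfl fun r _ => ?_
  rw [L.map_smul_univ (fun m => y (r m)), mono_fiber]
  simp

lemma moment_poly (n k : ℕ) (φ : EuclideanSpace ℝ (Fin n) → ℂ) (hφ : VanishingMoments n k φ)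
    (j : ℕ) (hj : j + 1 ≤ k) (L : (EuclideanSpace ℝ (Fin n)) [×j]→L[ℝ] ℂ) :
    Integrable (fun y => φ y * L (fun _ => y)) ∧ (∫ y, φ y * L (fun _ => y)) = 0 := by
  have hα : ∀ r : Fin j → Fin n,
      (∑ i, (Finset.univ.filter (fun m => r m = i)).card) + 1 ≤ k := by
    intro r
    have := Finset.card_eq_sum_card_fiberwise (f := r) (s := Finset.univ) (t := Finset.univ)
      (by intro x _; simp)
    rw [← this]
    simpa using hj
  have he : (fun y => φ y * L (fun _ => y)) = fun y => ∑ r : Fin j → Fin n,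
      (φ y * mono n (fun i => (Finset.univ.filter (fun m => r m = i)).card) y) *
        L (fun m => EuclideanSpace.single (r m) (1 : ℝ)) := by
    funext y
    rw [multilinear_expand, Finset.mul_sum]
    refine Finset.sum_congr rfl fun r _ => ?_
    ring
  rw [he]
  have hi : ∀ r : Fin j → Fin n, Integrable (fun y =>
      (φ y * mono n (fun i => (Finset.univ.filter (fun m => r m = i)).card) y) *
        L (fun m => EuclideanSpace.single (r m) (1 : ℝ))) :=
    fun r => (hφ _ (hα r)).1.mul_const _
  refine ⟨integrable_finsetSum _ fun r _ => hi r, ?_⟩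
  rw [integral_finsetSum _ fun r _ => hi r]
  refine Finset.sum_eq_zero fun r _ => ?_
  rw [integral_mul_const, (hφ _ (hα r)).2, zero_mul]

lemma weight_le {E : Type*} [NormedAddCommGroup E] [NormedSpace ℝ E] (N : ℕ) (u y : E) (a : ℝ)
    (ha : |a| ≤ 1) :
    (1 + ‖u + a • y‖) ^ (-(N : ℝ)) ≤ (1 + ‖u‖) ^ (-(N : ℝ)) * (1 + ‖y‖) ^ N := by
  have h1 : ‖u‖ ≤ ‖u + a • y‖ + ‖y‖ := by
    have h2 : ‖u‖ ≤ ‖u + a • y‖ + ‖a • y‖ := by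
      simpa using norm_sub_le (u + a • y) (a • y)
    have h3 : ‖a • y‖ ≤ ‖y‖ := by
      rw [norm_smul, Real.norm_eq_abs]
      exact mul_le_of_le_one_left (norm_nonneg _) ha
    linarith
  have h4 : 1 + ‖u‖ ≤ (1 + ‖u + a • y‖) * (1 + ‖y‖) := by
    nlinarith [norm_nonneg (u + a • y), norm_nonneg y,
      mul_nonneg (norm_nonneg (u + a • y)) (norm_nonneg y)]
  have h5 := pow_le_pow_left₀ (by positivity) h4 N
  rw [mul_pow] at h5
  rw [Real.rpow_neg (by positivity), Real.rpow_neg (by positivity), Real.rpow_natCast,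
    Real.rpow_natCast, inv_mul_eq_div, le_div_iff₀ (by positivity),
    inv_mul_le_iff₀ (by positivity)]
  exact h5

lemma taylor_rem {E : Type*} [NormedAddCommGroup E] [NormedSpace ℝ E] (N m : ℕ) (h : E → ℂ)
    (hh : ContDiff ℝ (m + 1 : ℕ) h) (C : ℝ) (hC0 : 0 ≤ C)
    (hC : ∀ x, ‖iteratedFDeriv ℝ (m + 1) h x‖ ≤ C * (1 + ‖x‖) ^ (-(N : ℝ)))
    (s : ℝ) (hs0 : 0 < s) (hs1 : s ≤ 1) (u y : E) :
    ‖h (u - s • y) - ∑ j ∈ Finset.range (m + 1),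
      (((j.factorial : ℝ)⁻¹ * (-s) ^ j : ℝ) : ℂ) * iteratedFDeriv ℝ j h u (fun _ => y)‖
      ≤ C * s ^ (m + 1) * (1 + ‖u‖) ^ (-(N : ℝ)) * (1 + ‖y‖) ^ (N + (m + 1)) := by
  have hT := map_add_eq_sum_add_integral_iteratedFDeriv (f := h) (x := u) (y := (-s) • y) (n := m)
    (fun t _ => by exact_mod_cast hh.contDiffAt)
  have e1 : u - s • y = u + (-s) • y := by rw [neg_smul, sub_eq_add_neg]
  have e2 : ∀ j : ℕ, (((j.factorial : ℝ)⁻¹ * (-s) ^ j : ℝ) : ℂ) *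
      iteratedFDeriv ℝ j h u (fun _ => y)
      = (j.factorial : ℝ)⁻¹ • (iteratedFDeriv ℝ j h u (fun _ => (-s) • y)) := by
    intro j
    rw [(iteratedFDeriv ℝ j h u).map_smul_univ (fun _ => -s) (fun _ => y)]
    simp [mul_assoc]
  rw [e1, hT, Finset.sum_congr rfl fun j _ => e2 j, add_sub_cancel_left, norm_smul]
  have hI : ‖∫ t in (0:ℝ)..1, (1 - t) ^ m •
      iteratedFDeriv ℝ (m + 1) h (u + t • (-s) • y) (fun _ => (-s) • y)‖
      ≤ (C * s ^ (m + 1) * (1 + ‖u‖) ^ (-(N : ℝ)) * (1 + ‖y‖) ^ (N + (m + 1))) * |(1:ℝ) - 0| := by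
    apply intervalIntegral.norm_integral_le_of_norm_le_const
    intro t ht
    rw [Set.uIoc_of_le zero_le_one] at ht
    rw [norm_smul, norm_pow, Real.norm_eq_abs]
    have a1 : |1 - t| ^ m ≤ 1 := pow_le_one₀ (abs_nonneg _) (by rw [abs_le]; constructor <;> linarith [ht.1, ht.2])
    have a2 := (iteratedFDeriv ℝ (m + 1) h (u + t • (-s) • y)).le_opNorm (fun _ => (-s) • y)
    have a3 : ∏ _i : Fin (m + 1), ‖(-s) • y‖ = s ^ (m + 1) * ‖y‖ ^ (m + 1) := by
      rw [Finset.prod_const, Finset.card_univ, Fintype.card_fin, norm_smul, mul_pow, norm_neg,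
        Real.norm_eq_abs, abs_of_pos hs0]
    rw [a3] at a2
    have a4 := hC (u + t • (-s) • y)
    have a5 : (1 + ‖u + t • (-s) • y‖) ^ (-(N : ℝ)) ≤ (1 + ‖u‖) ^ (-(N : ℝ)) * (1 + ‖y‖) ^ N := by
      rw [smul_smul]
      apply weight_le
      rw [abs_mul, abs_neg, abs_of_pos ht.1, abs_of_pos hs0]
      exact mul_le_one₀ ht.2 hs0.le hs1
    have a6 : ‖y‖ ^ (m + 1) ≤ (1 + ‖y‖) ^ (m + 1) :=
      pow_le_pow_left₀ (norm_nonneg _) (by linarith) _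
    calc |1 - t| ^ m * ‖iteratedFDeriv ℝ (m + 1) h (u + t • (-s) • y) (fun _ => (-s) • y)‖
        ≤ 1 * ((C * ((1 + ‖u‖) ^ (-(N : ℝ)) * (1 + ‖y‖) ^ N)) *
            (s ^ (m + 1) * (1 + ‖y‖) ^ (m + 1))) := by
          gcongr
          refine a2.trans ?_
          gcongr
          exact a4.trans (by gcongr)
      _ = _ := by ring
  have hf : ‖((m.factorial : ℝ)⁻¹)‖ ≤ 1 := by
    rw [norm_inv, Real.norm_natCast]
    exact inv_le_one_of_one_le₀ (by exact_mod_cast m.factorial_pos)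
  calc _ ≤ 1 * _ := mul_le_mul hf hI (norm_nonneg _) zero_le_one
    _ = _ := by simp

lemma key_pointwise (n N k : ℕ) (hk : 1 ≤ k) (h φ : EuclideanSpace ℝ (Fin n) → ℂ)
    (hh : ContDiff ℝ k h)
    (hdec : ∃ Cf : ℝ, ∀ i : ℕ, i ≤ k → ∀ x,
          ‖iteratedFDeriv ℝ i h x‖ ≤ Cf * (1 + ‖x‖) ^ (-(N : ℝ)))
    (hφ : VanishingMoments n k φ)
    (hφd : ∃ Cg : ℝ, ∀ x, ‖φ x‖ ≤ Cg * (1 + ‖x‖) ^ (-((N : ℝ) + k + n + 1))) :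
    ∃ C : ℝ, 0 ≤ C ∧ ∀ s : ℝ, 0 < s → s ≤ 1 → ∀ u : EuclideanSpace ℝ (Fin n),
      ‖∫ y, φ y * h (u - s • y)‖ ≤ C * s ^ k * (1 + ‖u‖) ^ (-(N : ℝ)) := by
  obtain ⟨C, hC⟩ := hdec
  obtain ⟨D, hD⟩ := hφd
  obtain ⟨m, rfl⟩ : ∃ m, k = m + 1 := ⟨k - 1, by omega⟩
  have hC0 : 0 ≤ C := by
    have := (norm_nonneg _).trans (hC 0 (by omega) 0)
    simpa using this
  have hD0 : 0 ≤ D := by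
    have := (norm_nonneg _).trans (hD 0)
    simpa using this
  have hint : Integrable (fun y : EuclideanSpace ℝ (Fin n) => (1 + ‖y‖) ^ (-((n : ℝ) + 1))) := by
    apply integrable_one_add_norm
    simp
  refine ⟨D * C * ∫ y : EuclideanSpace ℝ (Fin n), (1 + ‖y‖) ^ (-((n : ℝ) + 1)),
    mul_nonneg (mul_nonneg hD0 hC0) (integral_nonneg fun y => by positivity), ?_⟩
  intro s hs0 hs1 u
  have hφi : Integrable φ := by
    have := (hφ (fun _ => 0) (by simp)).1
    simpa [mono] using this
  have hb : ∀ x, ‖h x‖ ≤ C := by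
    intro x
    have h0 := hC 0 (by omega) x
    rw [norm_iteratedFDeriv_zero] at h0
    refine h0.trans (mul_le_of_le_one_right hC0 ?_)
    exact Real.rpow_le_one_of_one_le_of_nonpos (by linarith [norm_nonneg x]) (by simp)
  have i1 : Integrable (fun y => φ y * h (u - s • y)) := by
    refine hφi.mul_bdd (c := C) ?_ (Filter.Eventually.of_forall fun y => hb _)
    have hc := hh.continuous
    exact (by fun_prop : Continuous fun y => h (u - s • y)).aestronglyMeasurable
  have i2 : ∀ j ∈ Finset.range (m + 1), Integrable (fun y => φ y *
      ((((j.factorial : ℝ)⁻¹ * (-s) ^ j : ℝ) : ℂ) * iteratedFDeriv ℝ j h u (fun _ => y))) ∧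
      ∫ y, φ y * ((((j.factorial : ℝ)⁻¹ * (-s) ^ j : ℝ) : ℂ) *
        iteratedFDeriv ℝ j h u (fun _ => y)) = 0 := by
    intro j hj
    obtain ⟨q1, q2⟩ := moment_poly n (m + 1) φ hφ j (by simpa [Nat.lt_iff_add_one_le] using hj)
      (iteratedFDeriv ℝ j h u)
    have e : (fun y => φ y *
      ((((j.factorial : ℝ)⁻¹ * (-s) ^ j : ℝ) : ℂ) * iteratedFDeriv ℝ j h u (fun _ => y)))
      = fun y => (((j.factorial : ℝ)⁻¹ * (-s) ^ j : ℝ) : ℂ) *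
        (φ y * iteratedFDeriv ℝ j h u (fun _ => y)) := by
      funext y; ring
    rw [e]
    refine ⟨q1.const_mul _, ?_⟩
    rw [integral_const_mul, q2, mul_zero]
  have i3 : ∫ y, φ y * h (u - s • y) = ∫ y, φ y * (h (u - s • y) -
      ∑ j ∈ Finset.range (m + 1),
      (((j.factorial : ℝ)⁻¹ * (-s) ^ j : ℝ) : ℂ) * iteratedFDeriv ℝ j h u (fun _ => y)) := by
    simp_rw [mul_sub, Finset.mul_sum]
    rw [integral_sub i1 (integrable_finsetSum _ fun j hj => (i2 j hj).1),
      integral_finsetSum _ fun j hj => (i2 j hj).1,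
      Finset.sum_eq_zero fun j hj => (i2 j hj).2, sub_zero]
  rw [i3]
  have hbd : ∀ y, ‖φ y * (h (u - s • y) - ∑ j ∈ Finset.range (m + 1),
      (((j.factorial : ℝ)⁻¹ * (-s) ^ j : ℝ) : ℂ) * iteratedFDeriv ℝ j h u (fun _ => y))‖
      ≤ (D * C * s ^ (m + 1) * (1 + ‖u‖) ^ (-(N : ℝ))) * (1 + ‖y‖) ^ (-((n : ℝ) + 1)) := by
    intro y
    rw [norm_mul]
    have t1 := taylor_rem N m h hh C hC0 (hC (m + 1) le_rfl) s hs0 hs1 u y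
    have hy : 0 < 1 + ‖y‖ := by positivity
    have e : (1 + ‖y‖) ^ (-((N : ℝ) + (m + 1 : ℕ) + n + 1)) * (1 + ‖y‖) ^ (N + (m + 1))
        = (1 + ‖y‖) ^ (-((n : ℝ) + 1)) := by
      rw [← Real.rpow_natCast, ← Real.rpow_add hy]
      congr 1
      push_cast
      ring
    calc _ ≤ (D * (1 + ‖y‖) ^ (-((N : ℝ) + (m + 1 : ℕ) + n + 1))) *
          (C * s ^ (m + 1) * (1 + ‖u‖) ^ (-(N : ℝ)) * (1 + ‖y‖) ^ (N + (m + 1))) := by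
          exact mul_le_mul (hD y) t1 (norm_nonneg _) (by positivity)
      _ = (D * C * s ^ (m + 1) * (1 + ‖u‖) ^ (-(N : ℝ))) *
          ((1 + ‖y‖) ^ (-((N : ℝ) + (m + 1 : ℕ) + n + 1)) * (1 + ‖y‖) ^ (N + (m + 1))) := by ring
      _ = _ := by rw [e]
  refine (norm_integral_le_of_norm_le (hint.const_mul _)
    (Filter.Eventually.of_forall hbd)).trans ?_
  rw [integral_const_mul]
  apply le_of_eq
  ring

lemma weight_memLp (n N : ℕ) (p : ℝ≥0∞) (hp : 1 ≤ p)
    (hNp : (n : ℝ≥0∞) < (N : ℝ≥0∞) * p) :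
    MemLp (fun x : EuclideanSpace ℝ (Fin n) => (1 + ‖x‖) ^ (-(N : ℝ))) p volume := by
  have hm : AEStronglyMeasurable
      (fun x : EuclideanSpace ℝ (Fin n) => (1 + ‖x‖) ^ (-(N : ℝ))) volume :=
    Measurable.aestronglyMeasurable (by fun_prop)
  rcases eq_or_ne p ∞ with rfl | hpt
  · refine memLp_top_of_bound hm 1 (Filter.Eventually.of_forall fun x => ?_)
    rw [Real.norm_of_nonneg (by positivity)]
    exact Real.rpow_le_one_of_one_le_of_nonpos (by linarith [norm_nonneg x]) (by simp)
  · have hp0 : p ≠ 0 := (zero_lt_one.trans_le hp).ne'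
    rw [← integrable_norm_rpow_iff hm hp0 hpt]
    have e : (fun x : EuclideanSpace ℝ (Fin n) => ‖(1 + ‖x‖) ^ (-(N : ℝ))‖ ^ p.toReal)
        = fun x => (1 + ‖x‖) ^ (-((N : ℝ) * p.toReal)) := by
      funext x
      rw [Real.norm_of_nonneg (by positivity), ← Real.rpow_mul (by positivity), neg_mul]
    rw [e]
    apply integrable_one_add_norm
    have := (ENNReal.toReal_lt_toReal (by simp) (ENNReal.mul_ne_top (by simp) hpt)).2 hNp
    simpa using this

lemma eLpNorm_dilate (n : ℕ) (w : EuclideanSpace ℝ (Fin n) → ℝ) (hw : Measurable w) (p : ℝ≥0∞)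
    (t : ℝ) (ht : 0 < t) :
    eLpNorm (fun x => w (t • x)) p volume
      = ENNReal.ofReal (t ^ (-(n : ℝ) / p.toReal)) * eLpNorm w p volume := by
  have h1 := eLpNorm_map_measure (μ := (volume : Measure (EuclideanSpace ℝ (Fin n)))) (p := p)
    (g := w) (f := fun x => t • x) hw.aestronglyMeasurable (by fun_prop)
  rw [Measure.map_addHaar_smul _ ht.ne'] at h1
  have hpos : 0 < |(t ^ Module.finrank ℝ (EuclideanSpace ℝ (Fin n)))⁻¹| := by positivity
  rw [eLpNorm_smul_measure_of_ne_zero (ENNReal.ofReal_pos.2 hpos).ne'] at h1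
  change eLpNorm (w ∘ fun x => t • x) p volume = _
  rw [← h1, smul_eq_mul]
  congr 1
  rw [ENNReal.ofReal_rpow_of_pos hpos]
  congr 1
  rw [abs_of_pos (by positivity), finrank_euclideanSpace_fin, ← Real.rpow_natCast,
    ← Real.rpow_neg ht.le, ← Real.rpow_mul ht.le]
  congr 1
  simp [div_eq_mul_inv]

/-- `L^p`-norm estimates (3.2) and (3.3) of Lemma 3.2 of Führ–Mayeli, Euclidean case,
for `1 ≤ p ≤ ∞` with `N·p > n`:
(i) if all partial derivatives of `f` up to order `k` have polynomial decay of order `N`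
and `g` has vanishing moments of order `k` and decay of order `N + k + n + 1`, then
`‖g * D_t f‖_p ≤ C′ t^{k + n(1 − 1/p)}` for `0 < t < 1`;
(ii) if all partial derivatives of `g` up to order `k` have polynomial decay of order `N`
and `f` has vanishing moments of order `k` and decay of order `N + k + n + 1`, then
`‖g * D_t f‖_p ≤ C′ t^{−k}` for `t > 1`. -/
theorem decay_conv_Lp (n N k : ℕ) (hk : 1 ≤ k) (p : ℝ≥0∞) (hp : 1 ≤ p)
    (hNp : (n : ℝ≥0∞) < (N : ℝ≥0∞) * p) :
    (∀ f g : EuclideanSpace ℝ (Fin n) → ℂ, ContDiff ℝ k f →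
      (∃ Cf : ℝ, ∀ i : ℕ, i ≤ k → ∀ x,
          ‖iteratedFDeriv ℝ i f x‖ ≤ Cf * (1 + ‖x‖) ^ (-(N : ℝ))) →
      Measurable g → VanishingMoments n k g →
      (∃ Cg : ℝ, ∀ x, ‖g x‖ ≤ Cg * (1 + ‖x‖) ^ (-((N : ℝ) + k + n + 1))) →
      ∃ C' : ℝ, ∀ t : ℝ, 0 < t → t < 1 →
        eLpNorm (conv n g (dil n t f)) p volume ≤
          ENNReal.ofReal (C' * t ^ ((k : ℝ) + n * (1 - 1 / p.toReal)))) ∧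
    (∀ f g : EuclideanSpace ℝ (Fin n) → ℂ, ContDiff ℝ k g →
      (∃ Cg : ℝ, ∀ i : ℕ, i ≤ k → ∀ x,
          ‖iteratedFDeriv ℝ i g x‖ ≤ Cg * (1 + ‖x‖) ^ (-(N : ℝ))) →
      Measurable f → VanishingMoments n k f →
      (∃ Cf : ℝ, ∀ x, ‖f x‖ ≤ Cf * (1 + ‖x‖) ^ (-((N : ℝ) + k + n + 1))) →
      ∃ C' : ℝ, ∀ t : ℝ, 1 < t →
        eLpNorm (conv n g (dil n t f)) p volume ≤
          ENNReal.ofReal (C' * t ^ (-(k : ℝ)))) := by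
  have hW := weight_memLp n N p hp hNp
  set W := eLpNorm (fun x : EuclideanSpace ℝ (Fin n) => (1 + ‖x‖) ^ (-(N : ℝ))) p volume with hWd
  have hWt : W = ENNReal.ofReal W.toReal := (ENNReal.ofReal_toReal hW.2.ne).symm
  constructor
  · intro f g hf hfd _ hg hgd
    obtain ⟨C, hC0, hC⟩ := key_pointwise n N k hk f g hf hfd hg hgd
    refine ⟨C * W.toReal, fun t ht0 ht1 => ?_⟩
    have hb : ∀ x, ‖conv n g (dil n t f) x‖ ≤
        ((C * t ^ (n + k)) • fun x : EuclideanSpace ℝ (Fin n) =>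
          (1 + ‖t • x‖) ^ (-(N : ℝ))) x := by
      intro x
      have e : conv n g (dil n t f) x = (t : ℂ) ^ n * ∫ y, g y * f (t • x - t • y) := by
        unfold conv dil
        rw [← integral_const_mul]
        congr 1
        funext y
        rw [smul_sub]
        ring
      rw [e, norm_mul, norm_pow, Complex.norm_real, Real.norm_of_nonneg ht0.le]
      have := mul_le_mul_of_nonneg_left (hC t ht0 ht1.le (t • x)) (pow_nonneg ht0.le n)
      refine this.trans (le_of_eq ?_)
      simp only [Pi.smul_apply, smul_eq_mul]
      ring
    refine (eLpNorm_mono_real hb).trans ?_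
    rw [eLpNorm_const_smul, eLpNorm_dilate n (fun x => (1 + ‖x‖) ^ (-(N : ℝ))) (by fun_prop) p t ht0,
      ← hWd, hWt, Real.enorm_of_nonneg (by positivity), ENNReal.toReal_ofReal ENNReal.toReal_nonneg,
      ← ENNReal.ofReal_mul (by positivity), ← ENNReal.ofReal_mul (by positivity)]
    apply ENNReal.ofReal_le_ofReal
    apply le_of_eq
    have e : t ^ ((k : ℝ) + n * (1 - 1 / p.toReal)) = t ^ (n + k) * t ^ (-(n : ℝ) / p.toReal) := by
      rw [← Real.rpow_natCast, ← Real.rpow_add ht0]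
      congr 1
      push_cast
      ring
    rw [e]
    ring
  · intro f g hg hgd _ hf hfd
    obtain ⟨C, hC0, hC⟩ := key_pointwise n N k hk g f hg hgd hf hfd
    refine ⟨C * W.toReal, fun t ht1 => ?_⟩
    have ht0 : 0 < t := by linarith
    have hb : ∀ x, ‖conv n g (dil n t f) x‖ ≤
        ((C * t⁻¹ ^ k) • fun x : EuclideanSpace ℝ (Fin n) =>
          (1 + ‖x‖) ^ (-(N : ℝ))) x := by
      intro x
      have e : conv n g (dil n t f) x = ∫ z, f z * g (x - t⁻¹ • z) := by
        have s1 : conv n g (dil n t f) x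
            = ∫ y, g (x - y) * ((t : ℂ) ^ n * f (t • y)) := by
          unfold conv dil
          rw [← integral_sub_left_eq_self _ _ x]
          simp
        have s2 := Measure.integral_comp_smul volume (fun z => f z * g (x - t⁻¹ • z)) t
        rw [finrank_euclideanSpace_fin, abs_of_pos (by positivity)] at s2
        have s3 : ∫ y, g (x - y) * ((t : ℂ) ^ n * f (t • y))
            = (t : ℂ) ^ n * ∫ y, f (t • y) * g (x - t⁻¹ • t • y) := by
          rw [← integral_const_mul]
          congr 1
          funext y
          rw [inv_smul_smul₀ ht0.ne']
          ring
        have htc : (t : ℂ) ≠ 0 := by exact_mod_cast ht0.ne'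
        rw [s1, s3, s2, Complex.real_smul]
        push_cast
        rw [← mul_assoc, mul_inv_cancel₀ (pow_ne_zero _ htc), one_mul]
      rw [e]
      exact hC t⁻¹ (by positivity) (inv_le_one_of_one_le₀ ht1.le) x
    refine (eLpNorm_mono_real hb).trans ?_
    rw [eLpNorm_const_smul, ← hWd, hWt, Real.enorm_of_nonneg (by positivity),
      ENNReal.toReal_ofReal ENNReal.toReal_nonneg, ← ENNReal.ofReal_mul (by positivity)]
    apply ENNReal.ofReal_le_ofReal
    apply le_of_eq
    rw [Real.rpow_neg ht0.le, Real.rpow_natCast, inv_pow]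
    ring
end

section
/- Let g ∈ 𝓢(ℝⁿ) be a Schwartz function all of whose moments vanish (∫ g(x) x^α dx = 0 for every multi-index α), and let f ∈ 𝓢(ℝⁿ). Then g * D_t f tends to 0 in the Schwartz topology as t → 0⁺; explicitly, for every multi-index α and every N ∈ ℕ: lim_{t→0⁺} sup_{x∈ℝⁿ} (1+|x|)^N |∂^α (g * D_t f)(x)| = 0. -/
open MeasureTheory

section helpers

set_option linter.unusedSectionVars false


theorem aux_remainder {n : ℕ} {F : Type} [NormedAddCommGroup F] [NormedSpace ℝ F]
    [CompleteSpace F] (f : SchwartzMap (EuclideanSpace ℝ (Fin n)) F) (N : ℕ) :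
    ∃ C : ℝ, 0 ≤ C ∧ ∀ a b : EuclideanSpace ℝ (Fin n),
      (1 + ‖a‖) ^ N * ‖f (a + b) - ∑ k ∈ Finset.range (N + 1),
        ((k.factorial : ℝ))⁻¹ • (iteratedFDeriv ℝ k f a (fun _ => b))‖
        ≤ C * ((1 + ‖b‖) ^ N * ‖b‖ ^ (N + 1)) := by
  set C : ℝ := 2 ^ N * (Finset.Iic (N, N + 1)).sup
    (fun m => SchwartzMap.seminorm ℝ m.1 m.2) f with hC
  have hdec : ∀ x, (1 + ‖x‖) ^ N * ‖iteratedFDeriv ℝ (N + 1) f x‖ ≤ C := fun x =>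
    SchwartzMap.one_add_le_sup_seminorm_apply (𝕜 := ℝ) (m := (N, N + 1)) le_rfl le_rfl f x
  have hC0 : 0 ≤ C := le_trans (by positivity) (hdec 0)
  refine ⟨C, hC0, fun a b => ?_⟩
  have hT := map_add_eq_sum_add_integral_iteratedFDeriv (f := f) (x := a) (y := b) (n := N)
    (fun t _ => f.contDiffAt (N + 1 : ℕ))
  rw [hT, add_sub_cancel_left]
  have hI : ‖∫ t in (0 : ℝ)..1, (1 - t) ^ N • iteratedFDeriv ℝ (N + 1) f (a + t • b) (fun _ => b)‖
      ≤ (C * ((1 + ‖b‖) ^ N * ‖b‖ ^ (N + 1)) / (1 + ‖a‖) ^ N) * |(1 : ℝ) - 0| := by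
    apply intervalIntegral.norm_integral_le_of_norm_le_const
    intro s hs
    rw [Set.uIoc_of_le zero_le_one] at hs
    have h1 : ‖(1 - s) ^ N‖ ≤ 1 := by
      rw [norm_pow]
      apply pow_le_one₀ (norm_nonneg _)
      rw [Real.norm_eq_abs, abs_le]
      constructor <;> linarith [hs.1, hs.2]
    have h2 : ‖iteratedFDeriv ℝ (N + 1) f (a + s • b) (fun _ => b)‖
        ≤ ‖iteratedFDeriv ℝ (N + 1) f (a + s • b)‖ * ‖b‖ ^ (N + 1) := by
      simpa using (iteratedFDeriv ℝ (N + 1) f (a + s • b)).le_opNorm (fun _ => b)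
    have hsb : ‖s • b‖ ≤ ‖b‖ := by
      rw [norm_smul, Real.norm_eq_abs, abs_of_pos hs.1]
      exact mul_le_of_le_one_left (norm_nonneg _) hs.2
    have h3 : 1 + ‖a‖ ≤ (1 + ‖a + s • b‖) * (1 + ‖b‖) := by
      have : ‖a‖ ≤ ‖a + s • b‖ + ‖s • b‖ := by
        simpa using norm_sub_le (a + s • b) (s • b)
      nlinarith [norm_nonneg (a + s • b), norm_nonneg b]
    have h4 : (1 + ‖a‖) ^ N ≤ (1 + ‖a + s • b‖) ^ N * (1 + ‖b‖) ^ N := by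
      rw [← mul_pow]
      exact pow_le_pow_left₀ (by positivity) h3 N
    rw [le_div_iff₀ (by positivity), norm_smul]
    calc _ ≤ 1 * (‖iteratedFDeriv ℝ (N + 1) f (a + s • b)‖ * ‖b‖ ^ (N + 1)) *
          ((1 + ‖a + s • b‖) ^ N * (1 + ‖b‖) ^ N) := by gcongr
      _ = ((1 + ‖a + s • b‖) ^ N * ‖iteratedFDeriv ℝ (N + 1) f (a + s • b)‖) *
          ((1 + ‖b‖) ^ N * ‖b‖ ^ (N + 1)) := by ring
      _ ≤ _ := by
        gcongr
        exact hdec _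
  rw [norm_smul]
  have hfac : ‖((N.factorial : ℝ))⁻¹‖ ≤ 1 := by
    rw [norm_inv, Real.norm_natCast]
    exact inv_le_one_of_one_le₀ (by exact_mod_cast Nat.factorial_pos N)
  rw [sub_zero, abs_one, mul_one, le_div_iff₀ (by positivity)] at hI
  calc _ ≤ (1 + ‖a‖) ^ N * (1 * ‖∫ t in (0 : ℝ)..1, (1 - t) ^ N •
        iteratedFDeriv ℝ (N + 1) f (a + t • b) (fun _ => b)‖) := by gcongr
    _ ≤ _ := by linarith

variable {n : ℕ} {F : Type} [NormedAddCommGroup F] [NormedSpace ℝ F] [NormedSpace ℂ F]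
  [SMulCommClass ℝ ℂ F] [IsScalarTower ℝ ℂ F]

theorem aux_integrable_multi (g : SchwartzMap (EuclideanSpace ℝ (Fin n)) ℂ) (k : ℕ) (c : ℝ)
    (A : ContinuousMultilinearMap ℝ (fun _ : Fin k => EuclideanSpace ℝ (Fin n)) F) :
    Integrable (fun y => g y • A (fun _ => c • y)) := by
  have h := (g.integrable_pow_mul volume k).const_mul (‖A‖ * |c| ^ k)
  refine h.mono' ?_ (Filter.Eventually.of_forall fun y => ?_)
  · apply Continuous.aestronglyMeasurable
    have := g.continuous
    have h2 : Continuous (fun y : EuclideanSpace ℝ (Fin n) => A (fun _ => c • y)) :=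
      A.cont.comp (by fun_prop)
    exact this.smul h2
  · rw [norm_smul]
    have := A.le_opNorm (fun _ => c • y)
    simp only [norm_smul, Finset.prod_const, Finset.card_univ, Fintype.card_fin, mul_pow,
      Real.norm_eq_abs] at this
    calc _ ≤ ‖g y‖ * (‖A‖ * (|c| ^ k * ‖y‖ ^ k)) := by gcongr
      _ = _ := by ring

theorem aux_integrable_mono (g : SchwartzMap (EuclideanSpace ℝ (Fin n)) ℂ) (k : ℕ)
    (r : Fin k → Fin n) : Integrable (fun y => g y * ∏ j, ((y (r j) : ℝ) : ℂ)) := by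
  have h := g.integrable_pow_mul volume k
  refine h.mono' ?_ (Filter.Eventually.of_forall fun y => ?_)
  · apply Continuous.aestronglyMeasurable
    have := g.continuous
    fun_prop
  · rw [norm_mul, mul_comm]
    gcongr
    rw [norm_prod]
    calc _ ≤ ∏ j : Fin k, ‖y‖ := by
          apply Finset.prod_le_prod (fun _ _ => norm_nonneg _)
          intro j _
          rw [Complex.norm_real]
          exact PiLp.norm_apply_le y (r j)
      _ = _ := by simp

theorem aux_moment [CompleteSpace F] (g : SchwartzMap (EuclideanSpace ℝ (Fin n)) ℂ)
    (hg : ∀ α : Fin n → ℕ, (∫ x, g x * mono n α x) = 0) (k : ℕ) (c : ℝ)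
    (A : ContinuousMultilinearMap ℝ (fun _ : Fin k => EuclideanSpace ℝ (Fin n)) F) :
    ∫ y, g y • A (fun _ => c • y) = 0 := by
  have key : ∀ y : EuclideanSpace ℝ (Fin n), g y • A (fun _ => c • y) =
      ∑ r : Fin k → Fin n, (g y * ∏ j, ((y (r j) : ℝ) : ℂ)) •
        ((c ^ k) • A (fun j => EuclideanSpace.basisFun (Fin n) ℝ (r j))) := by
    intro y
    have hy : y = ∑ i, y i • EuclideanSpace.basisFun (Fin n) ℝ i := by
      simpa using ((EuclideanSpace.basisFun (Fin n) ℝ).sum_repr y).symm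
    have h1 : A (fun _ => c • y) = c ^ k • A (fun _ => y) := by
      have := A.map_smul_univ (fun _ => c) (fun _ => y)
      simpa using this
    have h2 : A (fun _ => y) = ∑ r : Fin k → Fin n, (∏ j, y (r j)) •
        A (fun j => EuclideanSpace.basisFun (Fin n) ℝ (r j)) := by
      conv_lhs => rw [hy]
      rw [A.map_sum]
      refine Finset.sum_congr rfl fun r _ => ?_
      exact A.map_smul_univ (fun j => y (r j)) _
    rw [h1, h2, Finset.smul_sum, Finset.smul_sum]
    refine Finset.sum_congr rfl fun r _ => ?_
    rw [mul_smul, ← Complex.ofReal_prod, smul_comm (c ^ k)]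
    congr 1
    exact (algebraMap_smul ℂ (∏ j, y (r j)) (c ^ k • A (fun j =>
      EuclideanSpace.basisFun (Fin n) ℝ (r j)))).symm
  simp_rw [key]
  rw [integral_finsetSum _ fun r _ => (aux_integrable_mono g k r).smul_const _]
  refine Finset.sum_eq_zero fun r _ => ?_
  rw [integral_smul_const]
  have := hg (fun i => (Finset.univ.filter (fun j => r j = i)).card)
  have h3 : ∀ y : EuclideanSpace ℝ (Fin n), ∏ j, ((y (r j) : ℝ) : ℂ) =
      mono n (fun i => (Finset.univ.filter (fun j => r j = i)).card) y := by
    intro y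
    unfold mono
    rw [← Finset.prod_fiberwise Finset.univ r]
    refine Finset.prod_congr rfl fun i _ => ?_
    rw [← Finset.prod_const]
    refine Finset.prod_congr rfl fun j hj => ?_
    rw [(Finset.mem_filter.1 hj).2]
  simp_rw [h3, this, zero_smul]

theorem aux_integrable_conv (g : SchwartzMap (EuclideanSpace ℝ (Fin n)) ℂ)
    (f : SchwartzMap (EuclideanSpace ℝ (Fin n)) F) (t : ℝ) (x : EuclideanSpace ℝ (Fin n)) :
    Integrable (fun y => g y • f (t • (x - y))) := by
  have h := (g.integrable (μ := volume)).norm.mul_const (SchwartzMap.seminorm ℝ 0 0 f)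
  refine h.mono' ?_ (Filter.Eventually.of_forall fun y => ?_)
  · apply Continuous.aestronglyMeasurable
    have := g.continuous
    have := f.continuous
    fun_prop
  · rw [norm_smul]
    gcongr
    exact f.norm_le_seminorm ℝ _

theorem aux_base [CompleteSpace F] (g : SchwartzMap (EuclideanSpace ℝ (Fin n)) ℂ)
    (hg : ∀ α : Fin n → ℕ, (∫ x, g x * mono n α x) = 0)
    (f : SchwartzMap (EuclideanSpace ℝ (Fin n)) F) (N : ℕ) :
    ∃ C : ℝ, 0 ≤ C ∧ ∀ t : ℝ, 0 < t → t ≤ 1 → ∀ x : EuclideanSpace ℝ (Fin n),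
      (1 + ‖x‖) ^ N * ‖∫ y, g y • f (t • (x - y))‖ ≤ C * t := by
  obtain ⟨C, hC0, hC⟩ := aux_remainder f N
  have hbdInt : Integrable (fun y => C * (‖g y‖ * ((1 + ‖y‖) ^ N * ‖y‖ ^ (N + 1)))) := by
    apply Integrable.const_mul
    have : ∀ y : EuclideanSpace ℝ (Fin n), ‖g y‖ * ((1 + ‖y‖) ^ N * ‖y‖ ^ (N + 1)) =
        ∑ m ∈ Finset.range (N + 1), (N.choose m : ℝ) * (‖y‖ ^ (m + (N + 1)) * ‖g y‖) := by
      intro y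
      rw [add_comm, add_pow, Finset.sum_mul, Finset.mul_sum]
      refine Finset.sum_congr rfl fun m _ => ?_
      ring
    simp_rw [this]
    exact integrable_finsetSum _ fun m _ => (g.integrable_pow_mul volume _).const_mul _
  refine ⟨∫ y, C * (‖g y‖ * ((1 + ‖y‖) ^ N * ‖y‖ ^ (N + 1))),
    integral_nonneg fun y => by positivity, fun t ht0 ht1 x => ?_⟩
  set P : EuclideanSpace ℝ (Fin n) → F := fun y => ∑ k ∈ Finset.range (N + 1),
    ((k.factorial : ℝ))⁻¹ • (iteratedFDeriv ℝ k f (t • x) (fun _ => (-t) • y)) with hP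
  have hgP : ∀ y, g y • P y = ∑ k ∈ Finset.range (N + 1),
      ((k.factorial : ℝ))⁻¹ • (g y • (iteratedFDeriv ℝ k f (t • x) (fun _ => (-t) • y))) := by
    intro y
    rw [hP, Finset.smul_sum]
    refine Finset.sum_congr rfl fun k _ => ?_
    rw [smul_comm]
  have hPi : ∀ k ∈ Finset.range (N + 1), Integrable (fun y => ((k.factorial : ℝ))⁻¹ •
      (g y • (iteratedFDeriv ℝ k f (t • x) (fun _ => (-t) • y)))) := fun k _ =>
    (aux_integrable_multi g k (-t) (iteratedFDeriv ℝ k f (t • x))).smul _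
  have hPint : Integrable (fun y => g y • P y) := by
    simp_rw [hgP]
    exact integrable_finsetSum _ hPi
  have hP0 : ∫ y, g y • P y = 0 := by
    simp_rw [hgP]
    rw [integral_finsetSum _ hPi]
    refine Finset.sum_eq_zero fun k _ => ?_
    rw [integral_smul, aux_moment g hg, smul_zero]
  have heq : ∫ y, g y • f (t • (x - y)) = ∫ y, g y • (f (t • x + (-t) • y) - P y) := by
    have hxy : ∀ y, t • (x - y) = t • x + (-t) • y := fun y => by module
    simp_rw [smul_sub (g _)]
    rw [integral_sub ?_ hPint, hP0, sub_zero]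
    · simp_rw [hxy]
    · have := aux_integrable_conv g f t x
      simp_rw [hxy] at this
      exact this
  rw [heq]
  have hx : (1 + ‖x‖) ^ N * t ^ N ≤ (1 + ‖t • x‖) ^ N := by
    rw [← mul_pow]
    apply pow_le_pow_left₀ (by positivity)
    rw [norm_smul, Real.norm_eq_abs, abs_of_pos ht0]
    nlinarith
  have hpt : ∀ y, ‖g y • (f (t • x + (-t) • y) - P y)‖ ≤
      (t / (1 + ‖x‖) ^ N) * (C * (‖g y‖ * ((1 + ‖y‖) ^ N * ‖y‖ ^ (N + 1)))) := by
    intro y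
    have h1 := hC (t • x) ((-t) • y)
    have hn : ‖(-t) • y‖ = t * ‖y‖ := by
      rw [norm_smul, norm_neg, Real.norm_eq_abs, abs_of_pos ht0]
    have hle : t * ‖y‖ ≤ ‖y‖ := mul_le_of_le_one_left (norm_nonneg _) ht1
    rw [hn] at h1
    rw [norm_smul, div_mul_eq_mul_div, le_div_iff₀ (by positivity)]
    have h2 : (1 + ‖x‖) ^ N * t ^ N * ‖f (t • x + (-t) • y) - P y‖ ≤
        t ^ N * (t * (C * ((1 + ‖y‖) ^ N * ‖y‖ ^ (N + 1)))) := by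
      calc _ ≤ (1 + ‖t • x‖) ^ N * ‖f (t • x + (-t) • y) - P y‖ := by gcongr
        _ ≤ C * ((1 + t * ‖y‖) ^ N * (t * ‖y‖) ^ (N + 1)) := h1
        _ ≤ C * ((1 + ‖y‖) ^ N * (t * ‖y‖) ^ (N + 1)) := by gcongr
        _ = _ := by ring
    have h3 : (1 + ‖x‖) ^ N * ‖f (t • x + (-t) • y) - P y‖ ≤
        t * (C * ((1 + ‖y‖) ^ N * ‖y‖ ^ (N + 1))) := by
      refine le_of_mul_le_mul_left ?_ (pow_pos ht0 N)
      linarith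
    calc _ = ‖g y‖ * ((1 + ‖x‖) ^ N * ‖f (t • x + (-t) • y) - P y‖) := by ring
      _ ≤ ‖g y‖ * (t * (C * ((1 + ‖y‖) ^ N * ‖y‖ ^ (N + 1)))) := by gcongr
      _ = _ := by ring
  have hfin := norm_integral_le_of_norm_le (hbdInt.const_mul (t / (1 + ‖x‖) ^ N))
    (Filter.Eventually.of_forall hpt)
  rw [integral_const_mul, div_mul_eq_mul_div, le_div_iff₀ (by positivity)] at hfin
  linarith

theorem aux_fderiv (g : SchwartzMap (EuclideanSpace ℝ (Fin n)) ℂ)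
    (f : SchwartzMap (EuclideanSpace ℝ (Fin n)) F) (t : ℝ) (x : EuclideanSpace ℝ (Fin n)) :
    HasFDerivAt (fun x => ∫ y, g y • f (t • (x - y)))
      (t • ∫ y, g y • (SchwartzMap.fderivCLM ℝ (EuclideanSpace ℝ (Fin n)) F f) (t • (x - y))) x := by
  set f' := SchwartzMap.fderivCLM ℝ (EuclideanSpace ℝ (Fin n)) F f with hf'
  rw [← integral_smul]
  have hi := fun x => (aux_integrable_conv g f' t x).smul t
  refine hasFDerivAt_integral_of_dominated_of_fderiv_le
    (F := fun x y => g y • f (t • (x - y)))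
    (F' := fun x y => t • (g y • f' (t • (x - y))))
    (bound := fun y => |t| * (‖g y‖ * SchwartzMap.seminorm ℝ 0 0 f')) Filter.univ_mem
    (Filter.Eventually.of_forall fun x => (aux_integrable_conv g f t x).aestronglyMeasurable)
    (aux_integrable_conv g f t x) (hi x).aestronglyMeasurable
    (Filter.Eventually.of_forall fun y x _ => ?_)
    (((g.integrable (μ := volume)).norm.mul_const _).const_mul _)
    (Filter.Eventually.of_forall fun y x _ => ?_)
  · rw [norm_smul, norm_smul, Real.norm_eq_abs]
    gcongr
    exact f'.norm_le_seminorm ℝ _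
  · have h1 : HasFDerivAt (fun x : EuclideanSpace ℝ (Fin n) => t • (x - y))
        (t • ContinuousLinearMap.id ℝ _) x := ((hasFDerivAt_id x).sub_const y).const_smul t
    have h2 := ((f.hasFDerivAt (t • (x - y))).comp x h1).const_smul (g y)
    have h3 : t • g y • f' (t • (x - y)) = g y • (fderiv ℝ f (t • (x - y))).comp
        (t • ContinuousLinearMap.id ℝ (EuclideanSpace ℝ (Fin n))) := by
      ext v
      simp [hf', SchwartzMap.fderivCLM_apply, smul_comm t]
    rw [h3]
    exact h2

end helpers

theorem aux_main {n : ℕ} (g : SchwartzMap (EuclideanSpace ℝ (Fin n)) ℂ)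
    (hg : ∀ α : Fin n → ℕ, (∫ x, g x * mono n α x) = 0) (N : ℕ) (i : ℕ) :
    ∀ (F : Type) [NormedAddCommGroup F] [NormedSpace ℝ F] [NormedSpace ℂ F]
      [SMulCommClass ℝ ℂ F] [IsScalarTower ℝ ℂ F] [CompleteSpace F]
      (f : SchwartzMap (EuclideanSpace ℝ (Fin n)) F),
    ∃ C : ℝ, 0 ≤ C ∧ ∀ t : ℝ, 0 < t → t ≤ 1 → ∀ c : ℝ, |c| ≤ 1 →
      ∀ x : EuclideanSpace ℝ (Fin n),
      (1 + ‖x‖) ^ N * ‖iteratedFDeriv ℝ i (fun x => c • ∫ y, g y • f (t • (x - y))) x‖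
        ≤ C * t := by
  induction i with
  | zero =>
    intro F _ _ _ _ _ _ f
    obtain ⟨C, hC0, hC⟩ := aux_base g hg f N
    refine ⟨C, hC0, fun t h0 h1 c hc x => ?_⟩
    rw [norm_iteratedFDeriv_zero, norm_smul, Real.norm_eq_abs]
    calc _ ≤ (1 + ‖x‖) ^ N * (1 * ‖∫ y, g y • f (t • (x - y))‖) := by gcongr
      _ ≤ _ := by rw [one_mul]; exact hC t h0 h1 x
  | succ i ih =>
    intro F _ _ _ _ _ _ f
    obtain ⟨C, hC0, hC⟩ := ih (EuclideanSpace ℝ (Fin n) →L[ℝ] F)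
      (SchwartzMap.fderivCLM ℝ (EuclideanSpace ℝ (Fin n)) F f)
    refine ⟨C, hC0, fun t h0 h1 c hc x => ?_⟩
    rw [← norm_iteratedFDeriv_fderiv]
    have : fderiv ℝ (fun x => c • ∫ y, g y • f (t • (x - y))) = fun x => (c * t) •
        ∫ y, g y • (SchwartzMap.fderivCLM ℝ (EuclideanSpace ℝ (Fin n)) F f) (t • (x - y)) := by
      funext x
      have h := ((aux_fderiv g f t x).const_smul c).fderiv
      rw [smul_smul] at h
      exact h
    rw [this]
    refine hC t h0 h1 (c * t) ?_ x
    rw [abs_mul, abs_of_pos h0]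
    exact mul_le_one₀ hc h0.le h1

/-- If `g` is a Schwartz function with all moments vanishing and `f` is Schwartz, then
`g * D_t f → 0` in the Schwartz topology as `t → 0⁺`: every Schwartz seminorm
`sup_x (1+|x|)^N ‖∂^{(i)}(g * D_t f)(x)‖` tends to `0`. -/
theorem conv_dilate_tendsto_zero_schwartz (n : ℕ)
    (g f : SchwartzMap (EuclideanSpace ℝ (Fin n)) ℂ)
    (hg : ∀ α : Fin n → ℕ, (∫ x, g x * mono n α x) = 0) :
    ∀ i N : ℕ,
      Filter.Tendsto
        (fun t : ℝ => ⨆ x : EuclideanSpace ℝ (Fin n),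
          (1 + ‖x‖) ^ N * ‖iteratedFDeriv ℝ i (conv n ⇑g (dil n t ⇑f)) x‖)
        (nhdsWithin 0 (Set.Ioi 0)) (nhds 0) := by
  intro i N
  obtain ⟨C, hC0, hC⟩ := aux_main g hg N i ℂ f
  have hlim : Filter.Tendsto (fun t : ℝ => C * t) (nhdsWithin 0 (Set.Ioi 0)) (nhds 0) := by
    have : Filter.Tendsto (fun t : ℝ => C * t) (nhds 0) (nhds (C * 0)) :=
      (continuous_const.mul continuous_id).tendsto 0
    rw [mul_zero] at this
    exact this.mono_left nhdsWithin_le_nhds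
  refine squeeze_zero' (Filter.Eventually.of_forall fun t =>
    Real.iSup_nonneg fun x => by positivity) ?_ hlim
  filter_upwards [Ioc_mem_nhdsGT (zero_lt_one' ℝ)] with t ht
  refine ciSup_le fun x => ?_
  have heq : conv n ⇑g (dil n t ⇑f) = fun x => (t ^ n) • ∫ y, g y • f (t • (x - y)) := by
    funext x
    unfold conv dil
    rw [← integral_smul]
    congr 1
    funext y
    simp only [smul_eq_mul, Complex.real_smul, Complex.ofReal_pow]
    ring
  rw [heq]
  refine hC t ht.1 ht.2 (t ^ n) ?_ x
  rw [abs_pow, abs_of_pos ht.1]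
  exact pow_le_one₀ ht.1.le ht.2
end
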